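/- Let d ≥ 1, let T ⊆ ℝ^d be an open set with nonempty complement, let 0 < a < 1, let 0 < q < ∞ and let σ ∈ ℝ. Then there is a constant C > 1, depending only on d, a, q and σ, such that for every measurable function Ψ on T: C⁻¹ ∫_T |Ψ(x)|^q d(x)^{q−1−qσ} dx ≤ ∫_T ( ⨍_{B(x, a·d(x))} |Ψ(y)|^q dy ) d(x)^{q−1−qσ} dx ≤ C ∫_T |Ψ(x)|^q d(x)^{q−1−qσ} dx. -/

import Mathlib

open MeasureTheory Metric Set ENNReal

noncomputable section

/-- `wdist Ω x = dist(x, ℝ^d ∖ Ω)`. -/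
def wdist {d : ℕ} (Ω : Set (EuclideanSpace ℝ (Fin d))) (x : EuclideanSpace ℝ (Fin d)) : ℝ :=
  Metric.infDist x Ωᶜ

/-- The distance to the complement is positive on an open set. -/
theorem wdist_pos {d : ℕ} {T : Set (EuclideanSpace ℝ (Fin d))} (hT : IsOpen T)
    (hne : Tᶜ.Nonempty) {x : EuclideanSpace ℝ (Fin d)} (hx : x ∈ T) : 0 < wdist T x :=
  (hT.isClosed_compl.notMem_iff_infDist_pos hne).1 (fun h => h hx)

theorem mem_of_wdist_pos {d : ℕ} {T : Set (EuclideanSpace ℝ (Fin d))}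
    {x : EuclideanSpace ℝ (Fin d)} (hx : 0 < wdist T x) : x ∈ T := by
  by_contra h
  exact hx.ne' (Metric.infDist_zero_of_mem h)

theorem wdist_le_add_dist {d : ℕ} (T : Set (EuclideanSpace ℝ (Fin d)))
    (x y : EuclideanSpace ℝ (Fin d)) : wdist T x ≤ wdist T y + dist x y :=
  Metric.infDist_le_infDist_add_dist

theorem continuous_wdist {d : ℕ} (T : Set (EuclideanSpace ℝ (Fin d))) :
    Continuous (wdist T) :=
  Metric.continuous_infDist_pt _

/-- Powers of comparable positive numbers are comparable. -/
theorem ofReal_rpow_le_of_comparable {s t M : ℝ} (hs : 0 < s) (ht : 0 < t) (hM : 0 < M)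
    (hst : s ≤ M * t) (hts : t ≤ M * s) (β : ℝ) :
    ENNReal.ofReal s ^ β ≤ ENNReal.ofReal (M ^ |β|) * ENNReal.ofReal t ^ β := by
  rw [ENNReal.ofReal_rpow_of_pos hs, ENNReal.ofReal_rpow_of_pos ht,
    ← ENNReal.ofReal_mul (by positivity)]
  apply ENNReal.ofReal_le_ofReal
  rcases le_total 0 β with hβ | hβ
  · rw [abs_of_nonneg hβ, ← Real.mul_rpow hM.le ht.le]
    exact Real.rpow_le_rpow hs.le hst hβ
  · have h : (M * s) ^ β ≤ t ^ β := Real.rpow_le_rpow_of_nonpos ht hts hβ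
    rw [Real.mul_rpow hM.le hs.le] at h
    rw [abs_of_nonpos hβ, Real.rpow_neg hM.le]
    have hMβ : 0 < M ^ β := by positivity
    rwa [inv_mul_eq_div, le_div_iff₀ hMβ, mul_comm]

/-- The mass at `y` of the averaging kernel over the balls `B(x, a d(x))`, weighted by
`d(x) ^ β`. -/
def averagingMass {d : ℕ} (T : Set (EuclideanSpace ℝ (Fin d))) (a β : ℝ)
    (y : EuclideanSpace ℝ (Fin d)) : ℝ≥0∞ :=
  ∫⁻ x in T, {x | dist y x < a * wdist T x}.indicator
    (fun x => (volume (Metric.ball x (a * wdist T x)))⁻¹ * ENNReal.ofReal (wdist T x) ^ β) x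

theorem volume_ball_mono_radius {d : ℕ} (x y : EuclideanSpace ℝ (Fin d)) {r s : ℝ} (h : r ≤ s) :
    volume (Metric.ball x r) ≤ volume (Metric.ball y s) := by
  rw [Measure.addHaar_ball_center, Measure.addHaar_ball_center volume y]
  exact measure_mono (Metric.ball_subset_ball h)

theorem volume_ball_eq_mul {d : ℕ} (x : EuclideanSpace ℝ (Fin d)) {r s M : ℝ} (hM : 0 < M)
    (h : s = M * r) :
    volume (Metric.ball x s) = ENNReal.ofReal (M ^ d) * volume (Metric.ball x r) := by
  rw [h, Measure.addHaar_ball_mul_of_pos volume x hM, Measure.addHaar_ball_center volume x r,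
    finrank_euclideanSpace_fin]

theorem wdist_comparable_of_dist_lt {d : ℕ} {T : Set (EuclideanSpace ℝ (Fin d))} {a : ℝ}
    {x y : EuclideanSpace ℝ (Fin d)} (h : dist y x < a * wdist T x) :
    (1 - a) * wdist T x ≤ wdist T y ∧ wdist T y ≤ (1 + a) * wdist T x := by
  have h1 := wdist_le_add_dist T x y
  have h2 := wdist_le_add_dist T y x
  rw [dist_comm] at h1
  constructor <;> nlinarith

theorem comparable_of_wdist_bounds {a s t : ℝ} (ha0 : 0 < a) (ha1 : a < 1) (hs : 0 < s)
    (h1 : (1 - a) * s ≤ t) (h2 : t ≤ (1 + a) * s) :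
    s ≤ (1 + a) / (1 - a) * t ∧ t ≤ (1 + a) / (1 - a) * s := by
  have h : 0 < 1 - a := by linarith
  constructor
  · rw [div_mul_eq_mul_div, le_div_iff₀ h]
    nlinarith [mul_pos h hs]
  · rw [div_mul_eq_mul_div, le_div_iff₀ h]
    nlinarith [mul_pos h hs]

theorem averagingMass_le {d : ℕ} {T : Set (EuclideanSpace ℝ (Fin d))} (hT : IsOpen T)
    (hne : Tᶜ.Nonempty) {a : ℝ} (ha0 : 0 < a) (ha1 : a < 1) (β : ℝ)
    {y : EuclideanSpace ℝ (Fin d)} (hy : y ∈ T) :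
    averagingMass T a β y ≤
      ENNReal.ofReal (((1 + a) / (1 - a)) ^ |β| * ((1 + a) / (1 - a)) ^ d) *
        ENNReal.ofReal (wdist T y) ^ β := by
  have h1a : 0 < 1 - a := by linarith
  have hyp := wdist_pos hT hne hy
  set M := (1 + a) / (1 - a) with hM
  have hMpos : 0 < M := by positivity
  set r := a / (1 + a) * wdist T y with hr
  have hrpos : 0 < r := by positivity
  set c := (volume (Metric.ball y r))⁻¹ *
    (ENNReal.ofReal (M ^ |β|) * ENNReal.ofReal (wdist T y) ^ β) with hc
  calc averagingMass T a β y
      ≤ ∫⁻ x in T, (Metric.ball y (a / (1 - a) * wdist T y)).indicator (fun _ => c) x := by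
        refine setLIntegral_mono' hT.measurableSet fun x hx => ?_
        have hxp := wdist_pos hT hne hx
        refine Set.indicator_apply_le' (fun hxy => ?_) (fun _ => zero_le)
        obtain ⟨h1, h2⟩ := wdist_comparable_of_dist_lt hxy
        obtain ⟨h3, h4⟩ := comparable_of_wdist_bounds ha0 ha1 hxp h1 h2
        rw [Set.indicator_of_mem]
        · refine mul_le_mul' (ENNReal.inv_le_inv.2 (volume_ball_mono_radius y x ?_))
            (ofReal_rpow_le_of_comparable hxp hyp hMpos h3 h4 β)
          rw [hr, div_mul_eq_mul_div, div_le_iff₀ (by positivity)]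
          nlinarith
        · rw [Metric.mem_ball, dist_comm, div_mul_eq_mul_div, lt_div_iff₀ h1a]
          have : dist y x < a * wdist T x := hxy
          nlinarith
    _ ≤ ∫⁻ x, (Metric.ball y (a / (1 - a) * wdist T y)).indicator (fun _ => c) x :=
        setLIntegral_le_lintegral _ _
    _ = c * volume (Metric.ball y (a / (1 - a) * wdist T y)) :=
        lintegral_indicator_const Metric.isOpen_ball.measurableSet c
    _ = ENNReal.ofReal (M ^ |β| * M ^ d) * ENNReal.ofReal (wdist T y) ^ β *
          ((volume (Metric.ball y r))⁻¹ * volume (Metric.ball y r)) := by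
        rw [volume_ball_eq_mul (r := r) y hMpos (by rw [hr, hM]; field_simp), hc,
          ENNReal.ofReal_mul (by positivity)]
        ring
    _ = _ := by
        rw [ENNReal.inv_mul_cancel (Metric.measure_ball_pos _ _ hrpos).ne'
          measure_ball_lt_top.ne, mul_one]

theorem le_averagingMass {d : ℕ} {T : Set (EuclideanSpace ℝ (Fin d))} (hT : IsOpen T)
    (hne : Tᶜ.Nonempty) {a : ℝ} (ha0 : 0 < a) (ha1 : a < 1) (β : ℝ)
    {y : EuclideanSpace ℝ (Fin d)} (hy : y ∈ T) :
    ENNReal.ofReal (wdist T y) ^ β ≤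
      ENNReal.ofReal (((1 + a) / (1 - a)) ^ |β| * ((1 + a) / (1 - a)) ^ d) *
        averagingMass T a β y := by
  have h1a : 0 < 1 - a := by linarith
  have hyp := wdist_pos hT hne hy
  set M := (1 + a) / (1 - a) with hM
  have hMpos : 0 < M := by positivity
  set r := a / (1 + a) * wdist T y with hr
  set R := a / (1 - a) * wdist T y with hR
  have hRpos : 0 < R := by positivity
  have hmem : ∀ x ∈ Metric.ball y r, dist y x < a * wdist T x ∧ 0 < wdist T x := by
    intro x hx
    rw [Metric.mem_ball, dist_comm, hr, div_mul_eq_mul_div, lt_div_iff₀ (by positivity)] at hx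
    have h := wdist_le_add_dist T y x
    have h0 : 0 ≤ dist y x := dist_nonneg
    constructor <;> nlinarith
  have hsub : Metric.ball y r ⊆ T := fun x hx => mem_of_wdist_pos (hmem x hx).2
  have key : ∀ x ∈ Metric.ball y r,
      (volume (Metric.ball y R))⁻¹ * ENNReal.ofReal (wdist T y) ^ β ≤
      ENNReal.ofReal (M ^ |β|) * {x | dist y x < a * wdist T x}.indicator
        (fun x => (volume (Metric.ball x (a * wdist T x)))⁻¹ *
          ENNReal.ofReal (wdist T x) ^ β) x := by
    intro x hx
    obtain ⟨hxy, hxp⟩ := hmem x hx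
    obtain ⟨h1, h2⟩ := wdist_comparable_of_dist_lt hxy
    obtain ⟨h3, h4⟩ := comparable_of_wdist_bounds ha0 ha1 hxp h1 h2
    rw [Set.indicator_of_mem (show x ∈ {x | dist y x < a * wdist T x} from hxy), mul_left_comm]
    refine mul_le_mul' (ENNReal.inv_le_inv.2 (volume_ball_mono_radius x y ?_))
      (ofReal_rpow_le_of_comparable hyp hxp hMpos h4 h3 β)
    rw [hR, div_mul_eq_mul_div, le_div_iff₀ h1a]
    nlinarith
  calc ENNReal.ofReal (wdist T y) ^ β
      = ENNReal.ofReal (wdist T y) ^ β *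
          ((volume (Metric.ball y R))⁻¹ * volume (Metric.ball y R)) := by
        rw [ENNReal.inv_mul_cancel (Metric.measure_ball_pos _ _ hRpos).ne'
          measure_ball_lt_top.ne, mul_one]
    _ = ENNReal.ofReal (M ^ d) * (((volume (Metric.ball y R))⁻¹ *
          ENNReal.ofReal (wdist T y) ^ β) * volume (Metric.ball y r)) := by
        nth_rw 2 [volume_ball_eq_mul (s := R) (r := r) y hMpos (by rw [hr, hR, hM]; field_simp)]
        ring
    _ = ENNReal.ofReal (M ^ d) * ∫⁻ _ in Metric.ball y r, (volume (Metric.ball y R))⁻¹ *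
          ENNReal.ofReal (wdist T y) ^ β := by
        rw [setLIntegral_const]
    _ ≤ ENNReal.ofReal (M ^ d) * ∫⁻ x in Metric.ball y r, ENNReal.ofReal (M ^ |β|) *
          {x | dist y x < a * wdist T x}.indicator
            (fun x => (volume (Metric.ball x (a * wdist T x)))⁻¹ *
              ENNReal.ofReal (wdist T x) ^ β) x :=
        mul_le_mul_right (setLIntegral_mono' Metric.isOpen_ball.measurableSet key) _
    _ = ENNReal.ofReal (M ^ |β| * M ^ d) * ∫⁻ x in Metric.ball y r,
          {x | dist y x < a * wdist T x}.indicator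
            (fun x => (volume (Metric.ball x (a * wdist T x)))⁻¹ *
              ENNReal.ofReal (wdist T x) ^ β) x := by
        rw [lintegral_const_mul' _ _ ENNReal.ofReal_ne_top, ENNReal.ofReal_mul (by positivity)]
        ring
    _ ≤ _ := mul_le_mul_right (lintegral_mono_set hsub) _

theorem measurable_volume_ball_center {d : ℕ} {ρ : EuclideanSpace ℝ (Fin d) → ℝ}
    (hρ : Measurable ρ) : Measurable fun x => volume (Metric.ball x (ρ x)) := by
  have hmono : Monotone fun r : ℝ =>
      volume (Metric.ball (0 : EuclideanSpace ℝ (Fin d)) r) :=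
    fun r s h => volume_ball_mono_radius 0 0 h
  have h : (fun x => volume (Metric.ball x (ρ x))) =
      fun x => volume (Metric.ball (0 : EuclideanSpace ℝ (Fin d)) (ρ x)) :=
    funext fun x => Measure.addHaar_ball_center _ _ _
  rw [h]
  exact hmono.measurable.comp hρ

/-- Tonelli's theorem for the weighted Whitney-type averages. -/
theorem lintegral_average_eq_lintegral_mul_averagingMass {d : ℕ}
    {T : Set (EuclideanSpace ℝ (Fin d))} (hT : IsOpen T) {a : ℝ} (ha1 : a < 1)
    (hne : Tᶜ.Nonempty) (β : ℝ) {f : EuclideanSpace ℝ (Fin d) → ℝ≥0∞} (hf : Measurable f) :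
    ∫⁻ x in T, ((volume (Metric.ball x (a * wdist T x)))⁻¹ *
        ∫⁻ y in Metric.ball x (a * wdist T x), f y) * ENNReal.ofReal (wdist T x) ^ β =
      ∫⁻ y in T, f y * averagingMass T a β y := by
  have hw : Measurable (wdist T) := (continuous_wdist T).measurable
  set k : EuclideanSpace ℝ (Fin d) → ℝ≥0∞ := fun x =>
    (volume (Metric.ball x (a * wdist T x)))⁻¹ * ENNReal.ofReal (wdist T x) ^ β with hk
  have hkm : Measurable k :=
    (measurable_volume_ball_center (hw.const_mul a)).inv.mul (hw.ennreal_ofReal.pow_const β)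
  have hS : MeasurableSet {p : EuclideanSpace ℝ (Fin d) × EuclideanSpace ℝ (Fin d) |
      dist p.2 p.1 < a * wdist T p.1} :=
    measurableSet_lt (measurable_snd.dist measurable_fst) ((hw.comp measurable_fst).const_mul a)
  have hSx : ∀ y, MeasurableSet {x | dist y x < a * wdist T x} := fun y =>
    measurableSet_lt (measurable_const.dist measurable_id) (hw.const_mul a)
  calc _ = ∫⁻ x in T, ∫⁻ y in T, {p : EuclideanSpace ℝ (Fin d) × EuclideanSpace ℝ (Fin d) |
          dist p.2 p.1 < a * wdist T p.1}.indicator (fun p => f p.2 * k p.1) (x, y) := by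
        refine setLIntegral_congr_fun hT.measurableSet fun x hx => ?_
        have hsub : Metric.ball x (a * wdist T x) ⊆ T := by
          intro y hy
          have h := wdist_comparable_of_dist_lt hy
          have := wdist_pos hT hne hx
          exact mem_of_wdist_pos (by nlinarith)
        have hind : ∀ y, {p : EuclideanSpace ℝ (Fin d) × EuclideanSpace ℝ (Fin d) |
            dist p.2 p.1 < a * wdist T p.1}.indicator (fun p => f p.2 * k p.1) (x, y) =
            (Metric.ball x (a * wdist T x)).indicator (fun y => f y * k x) y := fun y => rfl
        simp only [hind]
        rw [setLIntegral_indicator Metric.isOpen_ball.measurableSet,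
          Set.inter_eq_left.2 hsub, lintegral_mul_const _ hf, hk]
        ring
    _ = ∫⁻ y in T, ∫⁻ x in T, {p : EuclideanSpace ℝ (Fin d) × EuclideanSpace ℝ (Fin d) |
          dist p.2 p.1 < a * wdist T p.1}.indicator (fun p => f p.2 * k p.1) (x, y) :=
        lintegral_lintegral_swap ((((hf.comp measurable_snd).mul
          (hkm.comp measurable_fst)).indicator hS).aemeasurable)
    _ = _ := by
        refine lintegral_congr fun y => ?_
        rw [averagingMass, ← lintegral_const_mul _ (hkm.indicator (hSx y))]
        refine lintegral_congr fun x => ?_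
        by_cases h : dist y x < a * wdist T x
        · rw [Set.indicator_of_mem (show (x, y) ∈ {p : EuclideanSpace ℝ (Fin d) ×
            EuclideanSpace ℝ (Fin d) | dist p.2 p.1 < a * wdist T p.1} from h),
            Set.indicator_of_mem (show x ∈ {x | dist y x < a * wdist T x} from h)]
        · rw [Set.indicator_of_notMem (show (x, y) ∉ {p : EuclideanSpace ℝ (Fin d) ×
            EuclideanSpace ℝ (Fin d) | dist p.2 p.1 < a * wdist T p.1} from h),
            Set.indicator_of_notMem (show x ∉ {x | dist y x < a * wdist T x} from h), mul_zero]

theorem unaveraged_comparable_averaged_qpower (d : ℕ) (hd : 1 ≤ d) (a q σ : ℝ)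
    (ha0 : 0 < a) (ha1 : a < 1) (hq0 : 0 < q) :
    ∃ C : ℝ, 1 < C ∧
      ∀ T : Set (EuclideanSpace ℝ (Fin d)), IsOpen T → Tᶜ.Nonempty →
        ∀ Ψ : EuclideanSpace ℝ (Fin d) → ℝ, Measurable Ψ →
          ENNReal.ofReal C⁻¹ *
              (∫⁻ x in T, (‖Ψ x‖₊ : ℝ≥0∞) ^ q * ENNReal.ofReal (wdist T x) ^ (q - 1 - q * σ)) ≤
            (∫⁻ x in T,
              ((volume (Metric.ball x (a * wdist T x)))⁻¹ *
                  ∫⁻ y in Metric.ball x (a * wdist T x), (‖Ψ y‖₊ : ℝ≥0∞) ^ q) *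
                ENNReal.ofReal (wdist T x) ^ (q - 1 - q * σ)) ∧
          (∫⁻ x in T,
              ((volume (Metric.ball x (a * wdist T x)))⁻¹ *
                  ∫⁻ y in Metric.ball x (a * wdist T x), (‖Ψ y‖₊ : ℝ≥0∞) ^ q) *
                ENNReal.ofReal (wdist T x) ^ (q - 1 - q * σ)) ≤
            ENNReal.ofReal C *
              (∫⁻ x in T, (‖Ψ x‖₊ : ℝ≥0∞) ^ q * ENNReal.ofReal (wdist T x) ^ (q - 1 - q * σ)) := by
  have h1a : 0 < 1 - a := by linarith
  have hM : 1 < (1 + a) / (1 - a) := by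
    rw [lt_div_iff₀ h1a]
    linarith
  have hC : 1 < ((1 + a) / (1 - a)) ^ |q - 1 - q * σ| * ((1 + a) / (1 - a)) ^ d :=
    one_lt_mul_of_le_of_lt (Real.one_le_rpow hM.le (abs_nonneg _))
      (one_lt_pow₀ hM (by omega))
  refine ⟨_, hC, fun T hT hne Ψ hΨ => ?_⟩
  have hf : Measurable fun x => (‖Ψ x‖₊ : ℝ≥0∞) ^ q := hΨ.nnnorm.coe_nnreal_ennreal.pow_const q
  rw [lintegral_average_eq_lintegral_mul_averagingMass hT ha1 hne _ hf]
  set C := ((1 + a) / (1 - a)) ^ |q - 1 - q * σ| * ((1 + a) / (1 - a)) ^ d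
  have hC0 : 0 < C := by linarith
  constructor
  · rw [ENNReal.ofReal_inv_of_pos hC0, ENNReal.inv_mul_le_iff (ENNReal.ofReal_pos.2 hC0).ne'
      ENNReal.ofReal_ne_top, ← lintegral_const_mul' _ _ ENNReal.ofReal_ne_top]
    refine setLIntegral_mono' hT.measurableSet fun y hy => ?_
    rw [mul_left_comm]
    exact mul_le_mul_right (le_averagingMass hT hne ha0 ha1 _ hy) _
  · rw [← lintegral_const_mul' _ _ ENNReal.ofReal_ne_top]
    refine setLIntegral_mono' hT.measurableSet fun y hy => ?_
    rw [mul_left_comm]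
    exact mul_le_mul_right (averagingMass_le hT hne ha0 ha1 _ hy) _
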